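/- arXiv:1703.09416 — 11 statements merged into one kernel-verified Lean document; each statement's English description precedes it below -/
import Mathlib

section
/- Let a and r be positive integers with a ≥ 2, gcd(a, r) = 1, and (a, r) ≠ (2, 1). Define the rational numbers g = (a−1)(a+r−1)/2, w₁ = (a/2)·∑_{l=1}^{a−1} (l + ⌊lr/a⌋ − 1)(l + ⌊lr/a⌋) + ∑_{l=1}^{a−1} (lr − ⌊lr/a⌋·a)(l + ⌊lr/a⌋) − g(g+1)/2, and w₂ = (a/2)·∑_{l=1}^{a−1} (l + ⌊lr/a⌋ − 1)(l + ⌊lr/a⌋) + ∑_{l=1}^{a−1} (a − l)(l + ⌊lr/a⌋) − g(g+1)/2. Then (3a+1)·(w₁ + (a+r)·w₂) > (g−1)·g·(g+1). -/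
theorem sum_Icc_one_intCast (n : ℕ) :
    ∑ l ∈ Finset.Icc (1 : ℤ) n, (l : ℚ) = n * (n + 1) / 2 := by
  induction n with
  | zero => simp
  | succ n ih =>
    have h : Finset.Icc (1 : ℤ) ((n + 1 : ℕ) : ℤ) =
        insert ((n : ℤ) + 1) (Finset.Icc (1 : ℤ) n) := by
      ext x
      simp only [Finset.mem_Icc, Finset.mem_insert]
      omega
    rw [h, Finset.sum_insert (by simp), ih]
    push_cast
    ring

theorem sum_Icc_one_intCast_sq (n : ℕ) :
    ∑ l ∈ Finset.Icc (1 : ℤ) n, (l : ℚ) ^ 2 = n * (n + 1) * (2 * n + 1) / 6 := by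
  induction n with
  | zero => simp
  | succ n ih =>
    have h : Finset.Icc (1 : ℤ) ((n + 1 : ℕ) : ℤ) =
        insert ((n : ℤ) + 1) (Finset.Icc (1 : ℤ) n) := by
      ext x
      simp only [Finset.mem_Icc, Finset.mem_insert]
      omega
    rw [h, Finset.sum_insert (by simp), ih]
    push_cast
    ring

/-- Multiplication by a unit modulo `a` permutes the nonzero residues. -/
theorem sum_Icc_mul_emod {M : Type*} [AddCommMonoid M] {a r : ℤ} (ha : 0 < a)
    (h : Int.gcd a r = 1) (f : ℤ → M) :
    ∑ l ∈ Finset.Icc (1 : ℤ) (a - 1), f (l * r % a) =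
      ∑ l ∈ Finset.Icc (1 : ℤ) (a - 1), f l := by
  have hc : IsCoprime a r := Int.isCoprime_iff_gcd_eq_one.mpr h
  have hmaps : Set.MapsTo (fun l : ℤ => l * r % a) (Finset.Icc (1 : ℤ) (a - 1))
      (Finset.Icc (1 : ℤ) (a - 1)) := by
    intro l hl
    simp only [Finset.coe_Icc, Set.mem_Icc] at hl ⊢
    have h0 := Int.emod_nonneg (l * r) ha.ne'
    have h1 := Int.emod_lt_of_pos (l * r) ha
    have h2 : l * r % a ≠ 0 := fun h2 => by
      have := Int.le_of_dvd (by omega) (hc.dvd_of_dvd_mul_right (Int.dvd_of_emod_eq_zero h2))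
      omega
    omega
  have hinj : Set.InjOn (fun l : ℤ => l * r % a) (Finset.Icc (1 : ℤ) (a - 1)) := by
    intro x hx y hy hxy
    simp only [Finset.coe_Icc, Set.mem_Icc] at hx hy
    have hd : a ∣ (x - y) * r := by
      rw [sub_mul]
      exact Int.dvd_of_emod_eq_zero (Int.emod_eq_emod_iff_emod_sub_eq_zero.mp hxy)
    have := Int.eq_zero_of_abs_lt_dvd (hc.dvd_of_dvd_mul_right hd)
      (abs_lt.mpr ⟨by omega, by omega⟩)
    omega
  exact Finset.sum_nbij (fun l : ℤ => l * r % a) (fun l hl => hmaps hl) hinj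
    (Finset.surjOn_of_injOn_of_card_le _ hmaps hinj le_rfl) (fun _ _ => rfl)

theorem intCast_floor_mul_div {a : ℤ} (ha : 0 < a) (l r : ℤ) :
    (⌊((l : ℚ) * (r : ℚ)) / (a : ℚ)⌋ : ℚ) =
      ((l : ℚ) * (r : ℚ) - ((l * r % a : ℤ) : ℚ)) / (a : ℚ) := by
  have ha' : (0 : ℚ) < a := by exact_mod_cast ha
  have hf : ⌊((l : ℚ) * (r : ℚ)) / (a : ℚ)⌋ = l * r / a := by
    rw [Int.floor_eq_iff, le_div_iff₀ ha', div_lt_iff₀ ha']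
    have h1 := Int.ediv_mul_le (l * r) ha.ne'
    have h2 := Int.lt_ediv_add_one_mul_self (l * r) ha
    exact ⟨by exact_mod_cast h1, by exact_mod_cast h2⟩
  rw [hf, eq_div_iff ha'.ne']
  have h := Int.mul_ediv_add_emod (l * r) a
  have h' : (a : ℚ) * ((l * r / a : ℤ) : ℚ) + ((l * r % a : ℤ) : ℚ) = l * r := by
    exact_mod_cast h
  linarith


/-- Proposition 2.1: for integers `a ≥ 2`, `r ≥ 1` with `gcd(a,r) = 1` and `(a,r) ≠ (2,1)`,
setting `g = (a-1)(a+r-1)/2` and `w₁`, `w₂` as below, one has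
`(3a+1)(w₁ + (a+r)w₂) > (g-1)g(g+1)`. -/
theorem prop_total_weight_inequality (a r : ℤ) (ha : 2 ≤ a) (hr : 1 ≤ r)
    (hgcd : Int.gcd a r = 1) (hne : ¬(a = 2 ∧ r = 1)) :
    let g : ℚ := ((a : ℚ) - 1) * ((a : ℚ) + (r : ℚ) - 1) / 2
    let w₁ : ℚ :=
      (a : ℚ) / 2 * ∑ l ∈ Finset.Icc (1 : ℤ) (a - 1),
          (((l : ℚ) + (⌊((l : ℚ) * (r : ℚ)) / (a : ℚ)⌋ : ℚ) - 1) *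
            ((l : ℚ) + (⌊((l : ℚ) * (r : ℚ)) / (a : ℚ)⌋ : ℚ))) +
        ∑ l ∈ Finset.Icc (1 : ℤ) (a - 1),
          (((l : ℚ) * (r : ℚ) - (⌊((l : ℚ) * (r : ℚ)) / (a : ℚ)⌋ : ℚ) * (a : ℚ)) *
            ((l : ℚ) + (⌊((l : ℚ) * (r : ℚ)) / (a : ℚ)⌋ : ℚ))) -
        g * (g + 1) / 2
    let w₂ : ℚ :=
      (a : ℚ) / 2 * ∑ l ∈ Finset.Icc (1 : ℤ) (a - 1),
          (((l : ℚ) + (⌊((l : ℚ) * (r : ℚ)) / (a : ℚ)⌋ : ℚ) - 1) *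
            ((l : ℚ) + (⌊((l : ℚ) * (r : ℚ)) / (a : ℚ)⌋ : ℚ))) +
        ∑ l ∈ Finset.Icc (1 : ℤ) (a - 1),
          (((a : ℚ) - (l : ℚ)) * ((l : ℚ) + (⌊((l : ℚ) * (r : ℚ)) / (a : ℚ)⌋ : ℚ))) -
        g * (g + 1) / 2
    (3 * (a : ℚ) + 1) * (w₁ + ((a : ℚ) + (r : ℚ)) * w₂) > (g - 1) * g * (g + 1) := by
  intro g w₁ w₂
  have ha0 : 0 < a := by omega
  have haQ : (a : ℚ) ≠ 0 := by exact_mod_cast ha0.ne'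
  have hS1 : ∑ l ∈ Finset.Icc (1 : ℤ) (a - 1), (l : ℚ) = ((a : ℚ) - 1) * a / 2 := by
    have h := sum_Icc_one_intCast (a - 1).toNat
    have e : (((a - 1).toNat : ℤ)) = a - 1 := Int.toNat_of_nonneg (by omega)
    have e' : (((a - 1).toNat : ℚ)) = a - 1 := by exact_mod_cast e
    rw [e, e'] at h
    rw [h]
    ring
  have hS2 : ∑ l ∈ Finset.Icc (1 : ℤ) (a - 1), (l : ℚ) ^ 2 =
      ((a : ℚ) - 1) * a * (2 * a - 1) / 6 := by
    have h := sum_Icc_one_intCast_sq (a - 1).toNat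
    have e : (((a - 1).toNat : ℤ)) = a - 1 := Int.toNat_of_nonneg (by omega)
    have e' : (((a - 1).toNat : ℚ)) = a - 1 := by exact_mod_cast e
    rw [e, e'] at h
    rw [h]
    ring
  have hT1 := (sum_Icc_mul_emod ha0 hgcd (fun l => (l : ℚ))).trans hS1
  have hT2 := (sum_Icc_mul_emod ha0 hgcd (fun l => (l : ℚ) ^ 2)).trans hS2
  obtain ⟨D, hD⟩ : ∃ D : ℚ,
      ∑ l ∈ Finset.Icc (1 : ℤ) (a - 1), (l : ℚ) * ((l * r % a : ℤ) : ℚ) = D := ⟨_, rfl⟩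
  have hDle : D ≤ ((a : ℚ) - 1) * a * (2 * a - 1) / 6 := by
    have h : 0 ≤ ∑ l ∈ Finset.Icc (1 : ℤ) (a - 1), ((l : ℚ) - ((l * r % a : ℤ) : ℚ)) ^ 2 :=
      Finset.sum_nonneg fun _ _ => sq_nonneg _
    have e : ∑ l ∈ Finset.Icc (1 : ℤ) (a - 1), ((l : ℚ) - ((l * r % a : ℤ) : ℚ)) ^ 2 =
        ∑ l ∈ Finset.Icc (1 : ℤ) (a - 1), (l : ℚ) ^ 2 -
          2 * ∑ l ∈ Finset.Icc (1 : ℤ) (a - 1), (l : ℚ) * ((l * r % a : ℤ) : ℚ) +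
          ∑ l ∈ Finset.Icc (1 : ℤ) (a - 1), ((l * r % a : ℤ) : ℚ) ^ 2 := by
      rw [Finset.mul_sum, ← Finset.sum_sub_distrib, ← Finset.sum_add_distrib]
      exact Finset.sum_congr rfl fun _ _ => by ring
    rw [e, hS2, hD, hT2] at h
    linarith
  have hlin (c₁ c₂ c₃ c₄ c₅ : ℚ) :
      ∑ l ∈ Finset.Icc (1 : ℤ) (a - 1), (c₁ * (l : ℚ) + c₂ * (l : ℚ) ^ 2 +
        c₃ * ((l * r % a : ℤ) : ℚ) + c₄ * ((l * r % a : ℤ) : ℚ) ^ 2 +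
        c₅ * ((l : ℚ) * ((l * r % a : ℤ) : ℚ))) =
      (c₁ + c₃) * (((a : ℚ) - 1) * a / 2) +
        (c₂ + c₄) * (((a : ℚ) - 1) * a * (2 * a - 1) / 6) + c₅ * D := by
    simp only [Finset.sum_add_distrib, ← Finset.mul_sum]
    rw [hS1, hS2, hT1, hT2, hD]
    ring
  obtain ⟨b, hb⟩ : ∃ b : ℚ, b = (a : ℚ) + r := ⟨_, rfl⟩
  have hr' : (r : ℚ) = b - a := by linarith
  have hX : ∑ l ∈ Finset.Icc (1 : ℤ) (a - 1),
      (((l : ℚ) + (⌊((l : ℚ) * (r : ℚ)) / (a : ℚ)⌋ : ℚ) - 1) *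
        ((l : ℚ) + (⌊((l : ℚ) * (r : ℚ)) / (a : ℚ)⌋ : ℚ))) =
      (-(b / a) + 1 / a) * (((a : ℚ) - 1) * a / 2) +
        (b ^ 2 / a ^ 2 + 1 / a ^ 2) * (((a : ℚ) - 1) * a * (2 * a - 1) / 6) +
        (-(2 * b / a ^ 2)) * D := by
    rw [← hlin]
    refine Finset.sum_congr rfl fun l _ => ?_
    rw [intCast_floor_mul_div ha0, hr']
    field_simp
    ring
  have hY : ∑ l ∈ Finset.Icc (1 : ℤ) (a - 1),
      (((l : ℚ) * (r : ℚ) - (⌊((l : ℚ) * (r : ℚ)) / (a : ℚ)⌋ : ℚ) * (a : ℚ)) *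
        ((l : ℚ) + (⌊((l : ℚ) * (r : ℚ)) / (a : ℚ)⌋ : ℚ))) =
      (0 + 0) * (((a : ℚ) - 1) * a / 2) +
        (0 + -(1 / a)) * (((a : ℚ) - 1) * a * (2 * a - 1) / 6) + (b / a) * D := by
    rw [← hlin]
    refine Finset.sum_congr rfl fun l _ => ?_
    rw [intCast_floor_mul_div ha0, hr']
    field_simp
    ring
  have hZ : ∑ l ∈ Finset.Icc (1 : ℤ) (a - 1),
      (((a : ℚ) - (l : ℚ)) * ((l : ℚ) + (⌊((l : ℚ) * (r : ℚ)) / (a : ℚ)⌋ : ℚ))) =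
      (b + -1) * (((a : ℚ) - 1) * a / 2) +
        (-(b / a) + 0) * (((a : ℚ) - 1) * a * (2 * a - 1) / 6) + (1 / a) * D := by
    rw [← hlin]
    refine Finset.sum_congr rfl fun l _ => ?_
    rw [intCast_floor_mul_div ha0, hr']
    field_simp
    ring
  have hg : g = ((a : ℚ) - 1) * (b - 1) / 2 := by
    rw [hb]
  have haq : (2 : ℚ) ≤ a := by exact_mod_cast ha
  have hb4 : (4 : ℚ) ≤ b := by
    rw [hb]
    have : 4 ≤ a + r := by omega
    exact_mod_cast this
  have hw : w₁ + ((a : ℚ) + r) * w₂ =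
      g * ((a - 1) * (b - 1) ^ 2 / 12 + (b - 1) ^ 2 / 6 - 1) +
        b * (b - 1) / a * (((a : ℚ) - 1) * a * (2 * a - 1) / 6 - D) := by
    simp only [w₁, w₂]
    rw [hX, hY, hZ, hg, ← hb]
    field_simp
    ring
  have hgpos : 0 < g := by
    rw [hg]
    have : 0 < ((a : ℚ) - 1) * (b - 1) := mul_pos (by linarith) (by linarith)
    linarith
  have hrem : 0 ≤ b * (b - 1) / a * (((a : ℚ) - 1) * a * (2 * a - 1) / 6 - D) :=
    mul_nonneg (div_nonneg (mul_nonneg (by linarith) (by linarith)) (by linarith)) (by linarith)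
  have hkey : g ^ 2 - 1 < (3 * (a : ℚ) + 1) *
      ((a - 1) * (b - 1) ^ 2 / 12 + (b - 1) ^ 2 / 6 - 1) := by
    have hB : (9 : ℚ) ≤ (b - 1) ^ 2 := by nlinarith
    rw [hg]
    nlinarith [mul_nonneg (sub_nonneg.mpr haq) (sub_nonneg.mpr hB)]
  rw [hw, gt_iff_lt]
  calc (g - 1) * g * (g + 1) = g * (g ^ 2 - 1) := by ring
    _ < g * ((3 * (a : ℚ) + 1) * ((a - 1) * (b - 1) ^ 2 / 12 + (b - 1) ^ 2 / 6 - 1)) :=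
      mul_lt_mul_of_pos_left hkey hgpos
    _ ≤ _ := by
      rw [mul_add]
      have := mul_nonneg (by linarith : (0 : ℚ) ≤ 3 * a + 1) hrem
      linarith
end

section
/- Let a and r be positive integers with a ≥ 2 and gcd(a, r) = 1. Then 6·∑_{l=1}^{a−1} l·⌊lr/a⌋ ≥ (r−1)(a−1)(2a−1). -/
/-- For `r` prime to `a`, the map `l ↦ l * r % a` permutes the nonzero residues modulo `a`. -/
theorem image_mul_emod_Icc (a r : ℤ) (ha : 2 ≤ a) (hgcd : Int.gcd a r = 1) :
    (Finset.Icc (1 : ℤ) (a - 1)).image (fun l => l * r % a) = Finset.Icc 1 (a - 1) ∧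
      Set.InjOn (fun l => l * r % a) (Finset.Icc (1 : ℤ) (a - 1) : Set ℤ) := by
  have hcop : IsCoprime a r := Int.isCoprime_iff_gcd_eq_one.mpr hgcd
  have hinj : Set.InjOn (fun l => l * r % a) (Finset.Icc (1 : ℤ) (a - 1) : Set ℤ) := by
    intro x hx y hy hxy
    simp only [Finset.coe_Icc, Set.mem_Icc] at hx hy
    have hdvd : a ∣ (x - y) * r := by
      rw [sub_mul]
      exact Int.dvd_of_emod_eq_zero (Int.emod_eq_emod_iff_emod_sub_eq_zero.mp hxy)
    have hzero := Int.eq_zero_of_abs_lt_dvd (hcop.dvd_of_dvd_mul_right hdvd)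
      (abs_lt.mpr ⟨by linarith, by linarith⟩)
    linarith
  refine ⟨Finset.eq_of_subset_of_card_le ?_ (Finset.card_image_of_injOn hinj).ge, hinj⟩
  intro y hy
  obtain ⟨l, hl, rfl⟩ := Finset.mem_image.mp hy
  rw [Finset.mem_Icc] at hl ⊢
  have hne : l * r % a ≠ 0 := fun h => by
    have := Int.le_of_dvd (by linarith) (hcop.dvd_of_dvd_mul_right (Int.dvd_of_emod_eq_zero h))
    linarith
  have hnonneg := Int.emod_nonneg (l * r) (by linarith : a ≠ 0)
  have hlt := Int.emod_lt_of_pos (l * r) (by linarith : 0 < a)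
  omega

theorem six_mul_sum_Icc_sq (n : ℕ) :
    6 * ∑ l ∈ Finset.Icc (1 : ℤ) n, l ^ 2 = (n : ℤ) * (n + 1) * (2 * n + 1) := by
  induction n with
  | zero => simp
  | succ n ih =>
    have hIcc : Finset.Icc (1 : ℤ) (n + 1 : ℕ) = insert ((n : ℤ) + 1) (Finset.Icc 1 (n : ℤ)) := by
      ext x
      simp only [Finset.mem_Icc, Finset.mem_insert]
      omega
    rw [hIcc, Finset.sum_insert (by simp), mul_add, ih]
    push_cast
    ring

/-- Lemma 2.3 (2): for `a ≥ 2`, `r ≥ 1` with `gcd(a,r) = 1`,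
`6·∑_{l=1}^{a−1} l·⌊lr/a⌋ ≥ (r−1)(a−1)(2a−1)`. -/
theorem lemma_floor_weighted_sum (a r : ℤ) (ha : 2 ≤ a) (hr : 1 ≤ r) (hgcd : Int.gcd a r = 1) :
    6 * (∑ l ∈ Finset.Icc (1 : ℤ) (a - 1), l * ⌊((l : ℚ) * (r : ℚ)) / (a : ℚ)⌋) ≥
      (r - 1) * (a - 1) * (2 * a - 1) := by
  have hfloor (l : ℤ) : ⌊((l : ℚ) * (r : ℚ)) / (a : ℚ)⌋ = l * r / a := by
    lift a to ℕ using by linarith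
    exact_mod_cast Rat.floor_intCast_div_natCast (l * r) a
  simp only [hfloor]
  obtain ⟨himage, hinj⟩ := image_mul_emod_Icc a r ha hgcd
  have hperm : ∑ l ∈ Finset.Icc (1 : ℤ) (a - 1), (l * r % a) ^ 2 =
      ∑ l ∈ Finset.Icc (1 : ℤ) (a - 1), l ^ 2 := by
    conv_rhs => rw [← himage, Finset.sum_image hinj]
  have hsq : 6 * ∑ l ∈ Finset.Icc (1 : ℤ) (a - 1), l ^ 2 = (a - 1) * a * (2 * a - 1) := by
    have h := six_mul_sum_Icc_sq (a - 1).toNat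
    rw [Int.toNat_of_nonneg (by linarith)] at h
    rw [h]
    ring
  have hterm : ∑ l ∈ Finset.Icc (1 : ℤ) (a - 1), (2 * r * l ^ 2 - 2 * a * (l * (l * r / a))) ≤
      ∑ l ∈ Finset.Icc (1 : ℤ) (a - 1), (l ^ 2 + (l * r % a) ^ 2) := by
    refine Finset.sum_le_sum fun l _ => ?_
    have hdiv : 2 * r * l ^ 2 - 2 * a * (l * (l * r / a)) = 2 * l * (l * r % a) := by
      linear_combination (-2 * l) * Int.mul_ediv_add_emod (l * r) a
    rw [hdiv]
    exact two_mul_le_add_sq l (l * r % a)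
  rw [Finset.sum_sub_distrib, Finset.sum_add_distrib, ← Finset.mul_sum, ← Finset.mul_sum,
    hperm] at hterm
  refine le_of_mul_le_mul_left ?_ (by linarith : 0 < a)
  linear_combination 3 * hterm - (r - 1) * hsq
end

section
/- Let a and r be positive integers with a ≥ 2 and gcd(a, r) = 1. Then ∑_{l=1}^{a−1} (lr − ⌊lr/a⌋·a)(l + ⌊lr/a⌋) ≥ ∑_{l=1}^{a−1} (a − l)(l + ⌊lr/a⌋). (Equivalently, w₁ ≥ w₂, where w₁ and w₂ are the quantities obtained by adding (a/2)·∑_{l=1}^{a−1} (l + ⌊lr/a⌋ − 1)(l + ⌊lr/a⌋) − g(g+1)/2 to each side, with g = (a−1)(a+r−1)/2.) -/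
/-- The rearrangement inequality for a self-map of a finset that is injective on it. -/
theorem AntivaryOn.sum_mul_le_sum_comp_mul_of_injOn {ι : Type*} {s : Finset ι} {f g : ι → ℤ}
    (hfg : AntivaryOn f g s) {σ : ι → ι} (hmaps : Set.MapsTo σ s s) (hinj : Set.InjOn σ s) :
    ∑ i ∈ s, f i * g i ≤ ∑ i ∈ s, f (σ i) * g i := by
  have hbij : Function.Bijective (hmaps.restrict σ s s) :=
    Finite.injective_iff_bijective.mp (hmaps.restrict_inj.mpr hinj)
  have hsub : Antivary (fun i : s => f i) (fun i : s => g i) :=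
    fun i j hij => hfg i.2 j.2 hij
  rw [← Finset.sum_coe_sort s, ← Finset.sum_coe_sort s]
  exact hsub.sum_mul_le_sum_comp_perm_mul (σ := Equiv.ofBijective _ hbij)

theorem Int.emod_mul_pos_of_gcd_eq_one {a r l : ℤ} (hgcd : Int.gcd a r = 1)
    (hl : 1 ≤ l) (hla : l < a) : 0 < l * r % a := by
  refine lt_of_le_of_ne (Int.emod_nonneg _ (by lia)) fun h => ?_
  have hdvd : a ∣ l :=
    Int.dvd_of_dvd_mul_left_of_gcd_one (Int.dvd_of_emod_eq_zero h.symm) hgcd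
  exact absurd (Int.le_of_dvd (by lia) hdvd) (by lia)

theorem Int.injOn_mul_emod_of_gcd_eq_one {a r : ℤ} (hgcd : Int.gcd a r = 1) :
    Set.InjOn (fun l : ℤ => l * r % a) (Finset.Icc 1 (a - 1)) := by
  intro x hx y hy hxy
  simp only [Finset.coe_Icc, Set.mem_Icc] at hx hy
  have hdvd : a ∣ x - y := by
    refine Int.dvd_of_dvd_mul_left_of_gcd_one ?_ hgcd
    rw [sub_mul]
    exact Int.dvd_of_emod_eq_zero (Int.emod_eq_emod_iff_emod_sub_eq_zero.mp hxy)
  have hzero : x - y = 0 := Int.eq_zero_of_abs_lt_dvd hdvd (abs_lt.mpr ⟨by lia, by lia⟩)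
  lia


/-- Lemma 2.4: for `a ≥ 2`, `r ≥ 1` with `gcd(a,r) = 1`,
`∑_{l=1}^{a−1} (lr − ⌊lr/a⌋·a)(l + ⌊lr/a⌋) ≥ ∑_{l=1}^{a−1} (a − l)(l + ⌊lr/a⌋)`
(equivalently, `w₁ ≥ w₂`). -/
theorem lemma_w1_ge_w2 (a r : ℤ) (ha : 2 ≤ a) (hr : 1 ≤ r) (hgcd : Int.gcd a r = 1) :
    (∑ l ∈ Finset.Icc (1 : ℤ) (a - 1),
        ((l * r - ⌊((l : ℚ) * (r : ℚ)) / (a : ℚ)⌋ * a) *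
          (l + ⌊((l : ℚ) * (r : ℚ)) / (a : ℚ)⌋))) ≥
      ∑ l ∈ Finset.Icc (1 : ℤ) (a - 1),
        ((a - l) * (l + ⌊((l : ℚ) * (r : ℚ)) / (a : ℚ)⌋)) := by
  have hfloor (l : ℤ) : ⌊((l : ℚ) * (r : ℚ)) / (a : ℚ)⌋ = l * r / a := by
    have := Rat.floor_intCast_div_natCast (l * r) a.toNat
    rwa [← Int.cast_natCast, Int.toNat_of_nonneg (by lia), Int.cast_mul] at this
  have hmod (l : ℤ) : l * r - l * r / a * a = a - (a - l * r % a) := by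
    linarith [Int.emod_add_mul_ediv (l * r) a, mul_comm a (l * r / a)]
  simp only [hfloor, hmod]
  have hanti : AntivaryOn (fun l : ℤ => a - l) (fun l : ℤ => l + l * r / a)
      (Finset.Icc (1 : ℤ) (a - 1)) := by
    intro x _ y _ hlt
    by_contra! hlt'
    have hyx : y * r ≤ x * r := mul_le_mul_of_nonneg_right (by lia) (by lia)
    have hdiv := Int.ediv_le_ediv (show 0 < a by lia) hyx
    simp only at hlt hlt'
    lia
  refine hanti.sum_mul_le_sum_comp_mul_of_injOn (σ := fun l => a - l * r % a) ?_ ?_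
  · intro l hl
    simp only [Finset.coe_Icc, Set.mem_Icc] at hl ⊢
    have := Int.emod_mul_pos_of_gcd_eq_one hgcd hl.1 (by lia)
    have := Int.emod_lt_of_pos (l * r) (show 0 < a by lia)
    lia
  · intro x hx y hy hxy
    exact Int.injOn_mul_emod_of_gcd_eq_one hgcd hx hy (sub_right_injective hxy)
end

section
/- Let a and r be positive integers with a ≥ 2 and gcd(a, r) = 1. Then ∑_{l=1}^{a−1} (lr − ⌊lr/a⌋·a)(l + ⌊lr/a⌋) = ∑_{l=1}^{a−1} (a − l)(l + ⌊lr/a⌋) if and only if r ≡ a−1 (mod a). -/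
/-- Multiplication by a unit modulo `a` permutes the nonzero residues. -/
theorem sum_mul_emod_eq_sum (a r : ℤ) (hgcd : Int.gcd a r = 1) (f : ℤ → ℤ) :
    ∑ l ∈ Finset.Icc (1 : ℤ) (a - 1), f (l * r % a) = ∑ l ∈ Finset.Icc (1 : ℤ) (a - 1), f l := by
  have hco : IsCoprime a r := Int.isCoprime_iff_gcd_eq_one.mpr hgcd
  have hinj : Set.InjOn (fun l : ℤ => l * r % a) (Finset.Icc (1 : ℤ) (a - 1)) := by
    intro x hx y hy hxy
    simp only [Finset.coe_Icc, Set.mem_Icc] at hx hy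
    have hdvd : a ∣ x - y := hco.dvd_of_dvd_mul_right (by
      rw [sub_mul]
      exact Int.ModEq.dvd hxy.symm)
    have := Int.eq_zero_of_abs_lt_dvd hdvd (abs_lt.mpr ⟨by omega, by omega⟩)
    omega
  have hsub : (Finset.Icc (1 : ℤ) (a - 1)).image (fun l => l * r % a) ⊆ Finset.Icc 1 (a - 1) := by
    intro y hy
    obtain ⟨l, hl, rfl⟩ := Finset.mem_image.mp hy
    rw [Finset.mem_Icc] at hl ⊢
    have hnonneg := Int.emod_nonneg (l * r) (show a ≠ 0 by omega)
    have hlt := Int.emod_lt_of_pos (l * r) (show 0 < a by omega)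
    have hne : l * r % a ≠ 0 := fun h => by
      have := Int.le_of_dvd (by omega) (hco.dvd_of_dvd_mul_right (Int.dvd_of_emod_eq_zero h))
      omega
    omega
  rw [← Finset.sum_image (f := f) hinj,
    Finset.eq_of_subset_of_card_le hsub (Finset.card_image_of_injOn hinj).ge]

theorem sum_Icc_one_reflect (a : ℤ) (f : ℤ → ℤ) :
    ∑ l ∈ Finset.Icc (1 : ℤ) (a - 1), f (a - l) = ∑ l ∈ Finset.Icc (1 : ℤ) (a - 1), f l :=
  Finset.sum_nbij' (fun l => a - l) (fun l => a - l)
    (fun l hl => by rw [Finset.mem_Icc] at *; omega)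
    (fun l hl => by rw [Finset.mem_Icc] at *; omega)
    (fun l _ => by ring) (fun l _ => by ring) (fun l _ => rfl)

/-- The difference of the two weighted sums is, up to a factor, a sum of squares. -/
theorem two_mul_sum_sub_sum_eq_sum_sq (a r : ℤ) (hgcd : Int.gcd a r = 1) :
    2 * a * (∑ l ∈ Finset.Icc (1 : ℤ) (a - 1), (l * r - l * r / a * a) * (l + l * r / a) -
        ∑ l ∈ Finset.Icc (1 : ℤ) (a - 1), (a - l) * (l + l * r / a)) =
      (a + r - 1) * ∑ l ∈ Finset.Icc (1 : ℤ) (a - 1), (l * r % a + l - a) ^ 2 := by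
  have h₁ := sum_mul_emod_eq_sum a r hgcd (fun x => (a - x) ^ 2)
  have h₂ := sum_mul_emod_eq_sum a r hgcd (fun x => x ^ 2)
  have h₃ := sum_Icc_one_reflect a (fun x => x ^ 2)
  have key : 2 * a * (∑ l ∈ Finset.Icc (1 : ℤ) (a - 1),
        (l * r - l * r / a * a) * (l + l * r / a) -
        ∑ l ∈ Finset.Icc (1 : ℤ) (a - 1), (a - l) * (l + l * r / a)) -
      (a + r - 1) * ∑ l ∈ Finset.Icc (1 : ℤ) (a - 1), (l * r % a + l - a) ^ 2 =
      (a + r) * (∑ l ∈ Finset.Icc (1 : ℤ) (a - 1), l ^ 2 -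
        ∑ l ∈ Finset.Icc (1 : ℤ) (a - 1), (a - l * r % a) ^ 2) +
      (∑ l ∈ Finset.Icc (1 : ℤ) (a - 1), (a - l) ^ 2 -
        ∑ l ∈ Finset.Icc (1 : ℤ) (a - 1), (l * r % a) ^ 2) := by
    simp only [← Finset.sum_sub_distrib, Finset.mul_sum, ← Finset.sum_add_distrib]
    refine Finset.sum_congr rfl fun l _ => ?_
    have hx : l * r % a = l * r - a * (l * r / a) := Int.emod_def _ _
    rw [hx]
    ring
  rw [h₁, h₂, h₃] at key
  linarith

/-- Remark 2.5: for `a ≥ 2`, `r ≥ 1` with `gcd(a,r) = 1`, equality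
`∑_{l=1}^{a−1} (lr − ⌊lr/a⌋·a)(l + ⌊lr/a⌋) = ∑_{l=1}^{a−1} (a − l)(l + ⌊lr/a⌋)`
holds if and only if `r ≡ a−1 (mod a)`. -/
theorem remark_w1_eq_w2_iff (a r : ℤ) (ha : 2 ≤ a) (hr : 1 ≤ r) (hgcd : Int.gcd a r = 1) :
    (∑ l ∈ Finset.Icc (1 : ℤ) (a - 1),
        ((l * r - ⌊((l : ℚ) * (r : ℚ)) / (a : ℚ)⌋ * a) *
          (l + ⌊((l : ℚ) * (r : ℚ)) / (a : ℚ)⌋))) =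
      (∑ l ∈ Finset.Icc (1 : ℤ) (a - 1),
        ((a - l) * (l + ⌊((l : ℚ) * (r : ℚ)) / (a : ℚ)⌋))) ↔
    r ≡ a - 1 [ZMOD a] := by
  have hfloor (l : ℤ) : ⌊((l : ℚ) * (r : ℚ)) / (a : ℚ)⌋ = l * r / a := by
    lift a to ℕ using by omega
    simpa using Rat.floor_intCast_div_natCast (l * r) a
  simp only [hfloor]
  have key := two_mul_sum_sub_sum_eq_sum_sq a r hgcd
  have hzero : (∑ l ∈ Finset.Icc (1 : ℤ) (a - 1), (l * r - l * r / a * a) * (l + l * r / a) =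
      ∑ l ∈ Finset.Icc (1 : ℤ) (a - 1), (a - l) * (l + l * r / a)) ↔
      ∑ l ∈ Finset.Icc (1 : ℤ) (a - 1), (l * r % a + l - a) ^ 2 = 0 := by
    rw [← sub_eq_zero, ← mul_eq_zero_iff_left (show 2 * a ≠ 0 by omega), key,
      mul_eq_zero_iff_left (show a + r - 1 ≠ 0 by omega)]
  rw [hzero, Finset.sum_eq_zero_iff_of_nonneg fun _ _ => sq_nonneg _]
  constructor
  · intro h
    have h₁ := pow_eq_zero_iff two_ne_zero |>.mp (h 1 (Finset.mem_Icc.mpr ⟨le_rfl, by omega⟩))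
    rw [one_mul] at h₁
    rw [Int.ModEq, Int.emod_eq_of_lt (show 0 ≤ a - 1 by omega) (by omega)]
    omega
  · intro h l hl
    rw [Finset.mem_Icc] at hl
    have hmod : l * r ≡ a - l [ZMOD a] := (h.mul_left l).trans
      (Int.modEq_iff_dvd.mpr ⟨1 - l, by ring⟩)
    rw [hmod, Int.emod_eq_of_lt (by omega) (by omega)]
    ring
end

section
/- Let a and b be integers with 2 ≤ a < b and gcd(a, b) = 1. Then the number of gaps of the numerical semigroup ⟨a, b⟩ is (a−1)(b−1)/2; that is, the set ℕ \ ⟨a, b⟩ is finite of cardinality (a−1)(b−1)/2. -/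
/-- Every integer `x`, or else its reflection `ab - a - b - x`, is a combination of the coprime
numbers `a` and `b` with natural number coefficients. -/
theorem exists_combination_or_reflection {a b : ℕ} (hb : 0 < b) (h : Nat.Coprime a b) (x : ℤ) :
    (∃ m n : ℕ, x = m * a + n * b) ∨ ∃ m n : ℕ, (a * b - a - b - x : ℤ) = m * a + n * b := by
  obtain ⟨u, v, huv⟩ := Nat.isCoprime_iff_coprime.mpr h
  have hb' : (0 : ℤ) < b := by exact_mod_cast hb
  have hi0 := Int.emod_nonneg (x * u) hb'.ne'
  have hib := Int.emod_lt_of_pos (x * u) hb'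
  have hdm := Int.emod_add_mul_ediv (x * u) b
  generalize x * u % b = i at *
  generalize hq : x * u / b = q at *
  have hx : x = i * a + (x * v + q * a) * b := by linear_combination -x * huv - a * hdm
  generalize x * v + q * a = j at hx
  rcases le_or_gt 0 j with hj | hj
  · left
    lift i to ℕ using hi0
    lift j to ℕ using hj
    exact ⟨i, j, hx⟩
  · right
    obtain ⟨m, hm⟩ := Int.eq_ofNat_of_zero_le (show 0 ≤ b - 1 - i by lia)
    obtain ⟨n, hn⟩ := Int.eq_ofNat_of_zero_le (show 0 ≤ -1 - j by lia)
    exact ⟨m, n, by rw [← hm, ← hn, hx]; ring⟩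

/-- If `x + y` is the Frobenius number `ab - a - b`, exactly one of `x` and `y` is a gap of
`⟨a, b⟩`. -/
theorem gap_iff_of_add_eq_frobenius {a b x y : ℕ} (hb : 0 < b) (h : Nat.Coprime a b)
    (hxy : x + y + a + b = a * b) :
    (¬∃ m n : ℕ, x = m * a + n * b) ↔ ∃ m n : ℕ, y = m * a + n * b := by
  constructor
  · intro hx
    rcases exists_combination_or_reflection hb h x with ⟨m, n, hmn⟩ | ⟨m, n, hmn⟩
    · exact absurd ⟨m, n, by exact_mod_cast hmn⟩ hx
    · refine ⟨m, n, ?_⟩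
      zify at hxy ⊢
      linarith
  · rintro ⟨m, n, rfl⟩ ⟨k, l, rfl⟩
    refine Nat.Coprime.mul_add_mul_ne_mul h (Nat.succ_ne_zero (k + m)) (Nat.succ_ne_zero (l + n)) ?_
    rw [← hxy, Nat.succ_eq_add_one, Nat.succ_eq_add_one]
    ring

/-- Every gap of `⟨a, b⟩` is at most the Frobenius number `ab - a - b`. -/
theorem gap_add_le_mul {a b x : ℕ} (hb : 0 < b) (h : Nat.Coprime a b)
    (hx : ¬∃ m n : ℕ, x = m * a + n * b) : x + a + b ≤ a * b := by
  rcases exists_combination_or_reflection hb h x with ⟨m, n, hmn⟩ | ⟨m, n, hmn⟩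
  · exact absurd ⟨m, n, by exact_mod_cast hmn⟩ hx
  · have : (0 : ℤ) ≤ m * a + n * b := by positivity
    zify
    linarith

/-- Remark 2.7: for integers `2 ≤ a < b` with `gcd(a,b) = 1`, the set of gaps of the
numerical semigroup `⟨a,b⟩ = {ma + nb : m,n ∈ ℕ}` is finite of cardinality `(a−1)(b−1)/2`. -/
theorem genus_of_two_generated (a b : ℕ) (ha : 2 ≤ a) (hab : a < b) (hgcd : Nat.gcd a b = 1) :
    {x : ℕ | ¬∃ m n : ℕ, x = m * a + n * b}.Finite ∧
      {x : ℕ | ¬∃ m n : ℕ, x = m * a + n * b}.ncard = (a - 1) * (b - 1) / 2 := by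
  classical
  have hb : 0 < b := by lia
  have hN : (a - 1) * (b - 1) + a + b = a * b + 1 := by
    obtain ⟨c, rfl⟩ := Nat.exists_eq_add_of_le' (show 1 ≤ a by lia)
    obtain ⟨d, rfl⟩ := Nat.exists_eq_add_of_le' (show 1 ≤ b by lia)
    simp only [Nat.add_sub_cancel]
    ring
  generalize (a - 1) * (b - 1) = N at hN ⊢
  have hgaps : {x : ℕ | ¬∃ m n : ℕ, x = m * a + n * b} =
      ((Finset.range N).filter fun x ↦ ¬∃ m n : ℕ, x = m * a + n * b : Finset ℕ) := by
    ext x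
    simp only [Set.mem_ofPred_eq, Finset.coe_filter, Finset.mem_range]
    refine ⟨fun hx ↦ ⟨?_, hx⟩, And.right⟩
    have := gap_add_le_mul hb hgcd hx
    lia
  have hcard : ((Finset.range N).filter fun x ↦ ∃ m n : ℕ, x = m * a + n * b).card =
      ((Finset.range N).filter fun x ↦ ¬∃ m n : ℕ, x = m * a + n * b).card := by
    refine Finset.card_nbij' (fun x ↦ N - 1 - x) (fun x ↦ N - 1 - x) ?_ ?_ ?_ ?_
    · intro x hx
      simp only [Finset.coe_filter, Finset.mem_range, Set.mem_ofPred_eq] at hx ⊢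
      exact ⟨by lia, (gap_iff_of_add_eq_frobenius hb hgcd (by lia)).mpr hx.2⟩
    · intro x hx
      simp only [Finset.coe_filter, Finset.mem_range, Set.mem_ofPred_eq] at hx ⊢
      exact ⟨by lia, (gap_iff_of_add_eq_frobenius hb hgcd (by lia)).mp hx.2⟩
    all_goals
      intro x hx
      have := Finset.mem_range.mp (Finset.mem_filter.mp hx).1
      simp only
      lia
  have hsum := Finset.card_filter_add_card_filter_not (s := Finset.range N)
    fun x ↦ ∃ m n : ℕ, x = m * a + n * b
  rw [Finset.card_range] at hsum
  rw [hgaps, Set.ncard_coe_finset]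
  exact ⟨Finset.finite_toSet _, by lia⟩
end

section
/- Let a, b and t be positive integers with a < b, gcd(a, b) = 1 and t dividing a. Then { h ∈ ℕ : t·h ∈ ⟨a, b⟩ } = ⟨a/t, b⟩. -/
/-- Lemma 2.9: for positive integers `a < b` with `gcd(a,b) = 1` and `t ∣ a`,
`{h ∈ ℕ : t·h ∈ ⟨a,b⟩} = ⟨a/t, b⟩`. -/
theorem lemma_divide_semigroup (a b t : ℕ) (ha : 1 ≤ a) (ht : 1 ≤ t) (hab : a < b)
    (hgcd : Nat.gcd a b = 1) (hta : t ∣ a) :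
    {h : ℕ | ∃ m n : ℕ, t * h = m * a + n * b} =
      {x : ℕ | ∃ m n : ℕ, x = m * (a / t) + n * b} := by
  obtain ⟨c, rfl⟩ := hta
  have htb : Nat.Coprime t b := Nat.Coprime.coprime_mul_right hgcd
  rw [Nat.mul_div_cancel_left c ht]
  ext h
  constructor
  · rintro ⟨m, n, hmn⟩
    have hdvd : t ∣ n * b :=
      (Nat.dvd_add_right ⟨m * c, by ring⟩).mp (hmn ▸ dvd_mul_right t h)
    obtain ⟨k, rfl⟩ := htb.dvd_of_dvd_mul_right hdvd
    exact ⟨m, k, Nat.eq_of_mul_eq_mul_left ht (by rw [hmn]; ring)⟩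
  · rintro ⟨m, n, rfl⟩
    exact ⟨m, t * n, by ring⟩
end

section
/- Let a and r be integers with a ≥ 5, 2 ≤ r ≤ a−2 and gcd(a, r) = 1. Then the sum of the gaps of the numerical semigroup ⟨a, a+r⟩ equals (a/2)·∑_{l=1}^{a−1} (l + ⌊lr/a⌋ − 1)(l + ⌊lr/a⌋) + ∑_{l=1}^{a−1} (lr − ⌊lr/a⌋·a)(l + ⌊lr/a⌋); that is, ∑_{h ∈ ℕ \ ⟨a, a+r⟩} h equals that expression. (Equivalently, the Weierstrass weight of ⟨a, a+r⟩, namely the sum of its gaps minus g(g+1)/2 with g = (a−1)(a+r−1)/2, equals w₁.) -/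
/-- Every residue class modulo `a` contains a multiple `l * r` with `l < a` if `r` is coprime
to `a`. -/
theorem exists_lt_mul_modEq {a r : ℕ} (ha : 0 < a) (h : Nat.Coprime a r) (x : ℕ) :
    ∃ l < a, l * r ≡ x [MOD a] := by
  have : NeZero a := ⟨ha.ne'⟩
  refine ⟨((x : ZMod a) * (r : ZMod a)⁻¹).val, ZMod.val_lt _, ?_⟩
  rw [← ZMod.natCast_eq_natCast_iff]
  push_cast
  rw [ZMod.natCast_zmod_val, mul_assoc, mul_comm (r : ZMod a)⁻¹,
    ZMod.coe_mul_inv_eq_one r h.symm, mul_one]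

theorem eq_of_mul_modEq_of_lt {a r l n : ℕ} (h : Nat.Coprime a r) (hl : l < a)
    (hmod : n * r ≡ l * r [MOD a]) : n % a = l := by
  have := Nat.ModEq.cancel_right_of_coprime h hmod
  rwa [Nat.ModEq, Nat.mod_eq_of_lt hl] at this

theorem mul_add_eq_mod_add_mul (a r l : ℕ) :
    l * (a + r) = l * r % a + (l + l * r / a) * a := by
  have := Nat.mod_add_div (l * r) a
  linarith

/-- A number is a gap of `⟨a, a + r⟩` iff it is smaller than the element `l * (a + r)` of the
Apéry set of `a` in its residue class. -/
theorem not_mem_semigroup_iff {a r : ℕ} (ha : 0 < a) (h : Nat.Coprime a r) (x : ℕ) :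
    (¬∃ m n : ℕ, x = m * a + n * (a + r)) ↔
      ∃ l ∈ Finset.Icc 1 (a - 1), ∃ j < l + l * r / a, l * r % a + j * a = x := by
  constructor
  · intro hx
    obtain ⟨l, hl, hmod⟩ := exists_lt_mul_modEq ha h x
    have hdiv : l * r % a + x / a * a = x := by
      rw [show l * r % a = x % a from hmod]
      exact Nat.mod_add_div' x a
    have hj : x / a < l + l * r / a := by
      by_contra! hle
      obtain ⟨k, hk⟩ := Nat.exists_eq_add_of_le hle
      refine hx ⟨k, l, ?_⟩
      rw [mul_add_eq_mod_add_mul]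
      rw [hk] at hdiv
      linarith
    refine ⟨l, ?_, x / a, hj, hdiv⟩
    rw [Finset.mem_Icc]
    rcases Nat.eq_zero_or_pos l with rfl | hpos
    · simp at hj
    · omega
  · rintro ⟨l, hl, j, hj, rfl⟩ ⟨m, n, hmn⟩
    rw [Finset.mem_Icc] at hl
    have hmod : n * r ≡ l * r [MOD a] := by
      have hmn' := congrArg (· % a) hmn
      have hrw : m * a + n * (a + r) = n * r + (m + n) * a := by ring
      simp only [hrw, Nat.add_mul_mod_self_right, Nat.mod_mod] at hmn'
      exact hmn'.symm
    have hn : l ≤ n := eq_of_mul_modEq_of_lt h (by omega) hmod ▸ Nat.mod_le n a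
    have hle := Nat.mul_le_mul_right (a + r) hn
    rw [mul_add_eq_mod_add_mul a r l] at hle
    have hlt := Nat.mul_lt_mul_of_pos_right hj ha
    have := Nat.zero_le (m * a)
    linarith

theorem sum_range_add_mul (c a : ℚ) (q : ℕ) :
    ∑ j ∈ Finset.range q, (c + j * a) = a / 2 * (((q : ℚ) - 1) * q) + c * q := by
  induction q with
  | zero => simp
  | succ q ih =>
    rw [Finset.sum_range_succ, ih]
    push_cast
    ring

/-- The sum of the gaps of `⟨a, a + r⟩`, grouped by residue class modulo `a`. -/
theorem finsum_gaps_eq {a r : ℕ} (ha : 0 < a) (h : Nat.Coprime a r) :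
    (∑ᶠ x ∈ {x : ℕ | ¬∃ m n : ℕ, x = m * a + n * (a + r)}, (x : ℚ)) =
      ∑ l ∈ Finset.Icc 1 (a - 1), ∑ j ∈ Finset.range (l + l * r / a),
        (((l * r % a : ℕ) : ℚ) + j * a) := by
  classical
  have hset : {x : ℕ | ¬∃ m n : ℕ, x = m * a + n * (a + r)} =
      ↑(((Finset.Icc 1 (a - 1)).sigma fun l => Finset.range (l + l * r / a)).image
        fun p : (_ : ℕ) × ℕ => p.1 * r % a + p.2 * a) := by
    ext x
    rw [Set.mem_ofPred_eq, not_mem_semigroup_iff ha h]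
    simp [and_assoc]
  rw [hset, finsum_mem_coe_finset, Finset.sum_image, Finset.sum_sigma]
  · simp
  · rintro ⟨l, j⟩ hp ⟨l', j'⟩ hp' heq
    simp only [Finset.coe_sigma, Set.mem_sigma_iff, Finset.mem_coe, Finset.mem_Icc] at hp hp'
    dsimp only at heq
    have hmod : l * r ≡ l' * r [MOD a] := by
      have := congrArg (· % a) heq
      simpa [Nat.ModEq] using this
    have hl : l = l' := by
      rw [← eq_of_mul_modEq_of_lt h (by omega) hmod, Nat.mod_eq_of_lt (by omega)]
    subst hl
    have : j = j' := Nat.eq_of_mul_eq_mul_right ha (by omega)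
    rw [this]

theorem cast_floor_mul_div (l r a : ℕ) :
    ((⌊((l : ℚ) * (r : ℚ)) / (a : ℚ)⌋ : ℤ) : ℚ) = ((l * r / a : ℕ) : ℚ) := by
  have := Rat.floor_intCast_div_natCast (l * r : ℤ) a
  push_cast at this
  rw [this]
  norm_cast

/-- Lemma 3.1: for `a ≥ 5`, `2 ≤ r ≤ a−2` with `gcd(a,r) = 1`, the sum of the gaps of the
numerical semigroup `⟨a, a+r⟩` equals
`(a/2)·∑_{l=1}^{a−1} (l+⌊lr/a⌋−1)(l+⌊lr/a⌋) + ∑_{l=1}^{a−1} (lr−⌊lr/a⌋a)(l+⌊lr/a⌋)`. -/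
theorem lemma_weight_w1 (a r : ℕ) (ha : 5 ≤ a) (hr2 : 2 ≤ r) (hra : r ≤ a - 2)
    (hgcd : Nat.gcd a r = 1) :
    (∑ᶠ h ∈ {x : ℕ | ¬∃ m n : ℕ, x = m * a + n * (a + r)}, (h : ℚ)) =
      (a : ℚ) / 2 * ∑ l ∈ Finset.Icc 1 (a - 1),
          (((l : ℚ) + (⌊((l : ℚ) * (r : ℚ)) / (a : ℚ)⌋ : ℚ) - 1) *
            ((l : ℚ) + (⌊((l : ℚ) * (r : ℚ)) / (a : ℚ)⌋ : ℚ))) +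
        ∑ l ∈ Finset.Icc 1 (a - 1),
          (((l : ℚ) * (r : ℚ) - (⌊((l : ℚ) * (r : ℚ)) / (a : ℚ)⌋ : ℚ) * (a : ℚ)) *
            ((l : ℚ) + (⌊((l : ℚ) * (r : ℚ)) / (a : ℚ)⌋ : ℚ))) := by
  rw [finsum_gaps_eq (by omega) hgcd, Finset.mul_sum, ← Finset.sum_add_distrib]
  refine Finset.sum_congr rfl fun l _ => ?_
  have hmod : ((l * r % a : ℕ) : ℚ) = (l : ℚ) * r - ((l * r / a : ℕ) : ℚ) * a := by
    rw [eq_sub_iff_add_eq]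
    exact_mod_cast Nat.mod_add_div' (l * r) a
  rw [sum_range_add_mul, cast_floor_mul_div, hmod, Nat.cast_add]
end

section
/- Let a and r be integers with a ≥ 5, 2 ≤ r ≤ a−2 and gcd(a, r) = 1. Let H be the numerical semigroup generated by the set {a} ∪ { (a−l) + (l + ⌊lr/a⌋)·a : l = 1, ..., a−1 }. Then the sum of the gaps of H equals (a/2)·∑_{l=1}^{a−1} (l + ⌊lr/a⌋ − 1)(l + ⌊lr/a⌋) + ∑_{l=1}^{a−1} (a − l)(l + ⌊lr/a⌋); that is, ∑_{h ∈ ℕ \ H} h equals that expression. (Equivalently, the Weierstrass weight of H, namely the sum of its gaps minus g(g+1)/2 with g = (a−1)(a+r−1)/2, equals w₂.) -/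
/-- If `c (l + m) ≤ c l + c m + 1` and `c` is monotone, the gaps of the numerical semigroup generated
by `a` and the numbers `(a - l) + c l * a`, `1 ≤ l < a`, are the numbers `(a - l) + j * a` with
`j < c l`. -/
theorem notMem_closure_iff_of_kunz {a : ℕ} (ha : 0 < a) {c : ℕ → ℕ} (hmono : Monotone c)
    (hadd : ∀ l m, c (l + m) ≤ c l + c m + 1) (n : ℕ) :
    n ∉ AddSubmonoid.closure
        ({a} ∪ {x : ℕ | ∃ l : ℕ, 1 ≤ l ∧ l ≤ a - 1 ∧ x = (a - l) + c l * a}) ↔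
      ∃ l j, 1 ≤ l ∧ l < a ∧ j < c l ∧ n = (a - l) + j * a := by
  set S : Set ℕ := {a} ∪ {x : ℕ | ∃ l : ℕ, 1 ≤ l ∧ l ≤ a - 1 ∧ x = (a - l) + c l * a}
  have hmul : ∀ k, k * a ∈ AddSubmonoid.closure S := fun k => by
    simpa using AddSubmonoid.nsmul_mem _
      (AddSubmonoid.subset_closure (show a ∈ S from Or.inl rfl)) k
  constructor
  · intro hn
    rcases Nat.eq_zero_or_pos (n % a) with h0 | h0
    · refine absurd ?_ hn
      rw [← Nat.div_mul_cancel (Nat.dvd_of_mod_eq_zero h0)]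
      exact hmul _
    · have hlt := Nat.mod_lt n ha
      have hdm := Nat.mod_add_div' n a
      refine ⟨a - n % a, n / a, by omega, by omega, ?_, by omega⟩
      by_contra! hc
      refine hn ?_
      have hgen : (a - (a - n % a)) + c (a - n % a) * a ∈ AddSubmonoid.closure S :=
        AddSubmonoid.subset_closure (Or.inr ⟨a - n % a, by omega, by omega, rfl⟩)
      obtain ⟨d, hd⟩ := Nat.exists_eq_add_of_le hc
      have := AddSubmonoid.add_mem _ hgen (hmul d)
      convert this using 1
      rw [add_assoc, ← add_mul, ← hd]
      omega
  · rintro ⟨l, j, hl, hla, hj, rfl⟩ hmem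
    have key : ∀ x ∈ AddSubmonoid.closure S, (∃ k, x = k * a) ∨
        ∃ l j, 1 ≤ l ∧ l < a ∧ c l ≤ j ∧ x = (a - l) + j * a := by
      intro x hx
      induction hx using AddSubmonoid.closure_induction with
      | mem x hx =>
        rcases hx with rfl | ⟨l, h1, h2, rfl⟩
        · exact Or.inl ⟨1, by simp⟩
        · exact Or.inr ⟨l, c l, h1, by omega, le_rfl, rfl⟩
      | zero => exact Or.inl ⟨0, by simp⟩
      | add x y _ _ hx hy =>
        rcases hx with ⟨k, rfl⟩ | ⟨l, j, h1, h2, h3, rfl⟩ <;>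
          rcases hy with ⟨k', rfl⟩ | ⟨l', j', h1', h2', h3', rfl⟩
        · exact Or.inl ⟨k + k', by ring⟩
        · exact Or.inr ⟨l', k + j', h1', h2', by omega, by ring⟩
        · exact Or.inr ⟨l, j + k', h1, h2, by omega, by ring⟩
        · rcases lt_trichotomy (l + l') a with h | h | h
          · refine Or.inr ⟨l + l', j + j' + 1, by omega, h, ?_, ?_⟩
            · have := hadd l l'
              omega
            · rw [add_mul, add_mul, one_mul]
              omega
          · refine Or.inl ⟨j + j' + 1, ?_⟩
            rw [add_mul, add_mul, one_mul]
            omega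
          · refine Or.inr ⟨l + l' - a, j + j', by omega, by omega, ?_, ?_⟩
            · have : c (l + l' - a) ≤ c l := hmono (by omega)
              omega
            · rw [add_mul]
              omega
    have hmod : ∀ l j, 1 ≤ l → l < a → ((a - l) + j * a) % a = a - l := fun l j h1 h2 => by
      rw [Nat.add_mul_mod_self_right, Nat.mod_eq_of_lt (by omega)]
    rcases key _ hmem with ⟨k, hk⟩ | ⟨l', j', h1', h2', h3', hk⟩
    · have := congrArg (· % a) hk
      simp only [hmod l j hl hla, Nat.mul_mod_left] at this
      omega
    · have := congrArg (· % a) hk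
      simp only [hmod l j hl hla, hmod l' j' h1' h2'] at this
      obtain rfl : l = l' := by omega
      have : j = j' := Nat.eq_of_mul_eq_mul_right ha (Nat.add_left_cancel hk)
      omega

/-- The sum of the numbers `(a - l) + j * a` with `1 ≤ l < a` and `j < c l`. -/
theorem finsum_sub_add_mul (a : ℕ) (c : ℕ → ℕ) :
    ∑ᶠ h ∈ {x : ℕ | ∃ l j, 1 ≤ l ∧ l < a ∧ j < c l ∧ x = (a - l) + j * a}, (h : ℚ) =
      (a : ℚ) / 2 * ∑ l ∈ Finset.Icc 1 (a - 1), ((c l : ℚ) - 1) * c l +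
        ∑ l ∈ Finset.Icc 1 (a - 1), ((a : ℚ) - l) * c l := by
  have himage : {x : ℕ | ∃ l j, 1 ≤ l ∧ l < a ∧ j < c l ∧ x = (a - l) + j * a} =
      (((Finset.Icc 1 (a - 1)).sigma fun l => Finset.range (c l)).image
        fun p => (a - p.1) + p.2 * a : Finset ℕ) := by
    ext x
    simp only [Set.mem_ofPred_eq, Finset.coe_image, Set.mem_image, Finset.mem_coe,
      Finset.mem_sigma, Finset.mem_Icc, Finset.mem_range, Sigma.exists]
    constructor
    · rintro ⟨l, j, h1, h2, h3, rfl⟩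
      exact ⟨l, j, ⟨⟨h1, by omega⟩, h3⟩, rfl⟩
    · rintro ⟨l, j, ⟨⟨h1, h2⟩, h3⟩, rfl⟩
      exact ⟨l, j, h1, by omega, h3, rfl⟩
  rw [himage, finsum_mem_coe_finset, Finset.sum_image, Finset.sum_sigma, Finset.mul_sum,
    ← Finset.sum_add_distrib]
  · refine Finset.sum_congr rfl fun l hl => ?_
    rw [Finset.mem_Icc] at hl
    have hsum : ∀ n : ℕ, ∑ j ∈ Finset.range n, (((a - l) + j * a : ℕ) : ℚ) =
        (a : ℚ) / 2 * (((n : ℚ) - 1) * n) + ((a : ℚ) - l) * n := fun n => by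
      induction n with
      | zero => simp
      | succ n ih =>
        rw [Finset.sum_range_succ, ih]
        push_cast [Nat.cast_sub (show l ≤ a by omega)]
        ring
    exact hsum _
  · rintro ⟨l, j⟩ hp ⟨l', j'⟩ hp' h
    simp only [Finset.mem_coe, Finset.mem_sigma, Finset.mem_Icc, Finset.mem_range] at hp hp' h
    have hmod := congrArg (· % a) h
    simp only [Nat.add_mul_mod_self_right] at hmod
    rw [Nat.mod_eq_of_lt (by omega), Nat.mod_eq_of_lt (by omega)] at hmod
    obtain rfl : l = l' := by omega
    obtain rfl : j = j' :=
      Nat.eq_of_mul_eq_mul_right (show 0 < a by omega) (Nat.add_left_cancel h)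
    rfl


/-- Lemma 3.2: for `a ≥ 5`, `2 ≤ r ≤ a−2` with `gcd(a,r) = 1`, let `H` be the numerical
semigroup generated by `{a} ∪ {(a−l) + (l+⌊lr/a⌋)·a : l = 1, …, a−1}`. Then the sum of
the gaps of `H` equals
`(a/2)·∑_{l=1}^{a−1} (l+⌊lr/a⌋−1)(l+⌊lr/a⌋) + ∑_{l=1}^{a−1} (a−l)(l+⌊lr/a⌋)`. -/
theorem lemma_weight_w2 (a r : ℕ) (ha : 5 ≤ a) (hr2 : 2 ≤ r) (hra : r ≤ a - 2)
    (hgcd : Nat.gcd a r = 1) :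
    let H : AddSubmonoid ℕ := AddSubmonoid.closure
      ({a} ∪ {x : ℕ | ∃ l : ℕ, 1 ≤ l ∧ l ≤ a - 1 ∧ x = (a - l) + (l + l * r / a) * a})
    (∑ᶠ h ∈ {x : ℕ | x ∉ H}, (h : ℚ)) =
      (a : ℚ) / 2 * ∑ l ∈ Finset.Icc 1 (a - 1),
          (((l : ℚ) + (⌊((l : ℚ) * (r : ℚ)) / (a : ℚ)⌋ : ℚ) - 1) *
            ((l : ℚ) + (⌊((l : ℚ) * (r : ℚ)) / (a : ℚ)⌋ : ℚ))) +
        ∑ l ∈ Finset.Icc 1 (a - 1),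
          (((a : ℚ) - (l : ℚ)) * ((l : ℚ) + (⌊((l : ℚ) * (r : ℚ)) / (a : ℚ)⌋ : ℚ))) := by
  intro H
  have ha0 : 0 < a := by omega
  have hfloor : ∀ l : ℕ, (l : ℚ) + (⌊((l : ℚ) * (r : ℚ)) / (a : ℚ)⌋ : ℚ) =
      ((l + l * r / a : ℕ) : ℚ) := fun l => by
    have := Rat.floor_natCast_div_natCast (l * r) a
    push_cast at this
    rw [this]
    push_cast
    rfl
  have hmono : Monotone fun l => l + l * r / a := fun l m h =>
    Nat.add_le_add h (Nat.div_le_div_right (Nat.mul_le_mul_right r h))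
  have hadd : ∀ l m, (l + m) + (l + m) * r / a ≤ (l + l * r / a) + (m + m * r / a) + 1 := by
    intro l m
    have : (l + m) * r / a ≤ l * r / a + m * r / a + 1 := by
      rw [add_mul, Nat.add_div ha0]
      split_ifs <;> omega
    omega
  have hset : {x : ℕ | x ∉ H} = {x : ℕ | ∃ l j, 1 ≤ l ∧ l < a ∧ j < l + l * r / a ∧
      x = (a - l) + j * a} :=
    Set.ext fun n => notMem_closure_iff_of_kunz ha0 hmono hadd n
  simp only [hfloor, hset]
  exact finsum_sub_add_mul a fun l => l + l * r / a
end

section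
/- Let a and b be integers with 2 ≤ a < b and gcd(a, b) = 1, and let r̄ be the unique integer with 0 < r̄ ≤ a and b + 1 ≡ r̄ (mod a). Let H be the numerical semigroup generated by the set S = {a} ∪ { l(b + a − r̄) − ⌊l(a − r̄ + 1)/a⌋·a : l = 1, ..., a−1 }. Then the set of gaps of H is ℕ \ H = { l(b + a − r̄) − ⌊l(a − r̄ + 1)/a⌋·a − na : l ∈ {1, ..., a−1}, n ≥ 1, l(b + a − r̄) − ⌊l(a − r̄ + 1)/a⌋·a − na > 0 }. -/
/-- The candidate for the least element in the residue class of `-l` modulo `a`. -/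
def aperyElement (a c d l : ℕ) : ℕ := l * c - l * d / a * a

section aperyElement

variable {a c d : ℕ}

theorem aperyElement_add_div_mul (hdc : d ≤ c) (l : ℕ) :
    aperyElement a c d l + l * d / a * a = l * c :=
  Nat.sub_add_cancel ((Nat.div_mul_le_self _ _).trans (Nat.mul_le_mul_left l hdc))

theorem dvd_aperyElement_add (hdc : d ≤ c) (hc : a ∣ c + 1) (l : ℕ) :
    a ∣ aperyElement a c d l + l := by
  have h := aperyElement_add_div_mul (a := a) hdc l
  have h1 : a ∣ (aperyElement a c d l + l) + l * d / a * a := by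
    have h2 : (aperyElement a c d l + l) + l * d / a * a = l * (c + 1) := by linarith
    exact h2 ▸ hc.mul_left l
  exact (Nat.dvd_add_left (Nat.dvd_mul_left _ _)).1 h1

theorem aperyElement_add_le (hdc : d ≤ c) (l m : ℕ) :
    aperyElement a c d (l + m) ≤ aperyElement a c d l + aperyElement a c d m := by
  have h1 := aperyElement_add_div_mul (a := a) hdc l
  have h2 := aperyElement_add_div_mul (a := a) hdc m
  have h3 := aperyElement_add_div_mul (a := a) hdc (l + m)
  have h4 : l * d / a + m * d / a ≤ (l + m) * d / a := by
    rw [add_mul]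
    exact Nat.div_add_div_le_add_div
  have h5 := Nat.mul_le_mul_right a h4
  linarith

theorem aperyElement_le_add_mul (ha : 0 < a) (hdc : d ≤ c) (l t : ℕ) :
    aperyElement a c d l ≤ aperyElement a c d (l + a * t) := by
  have h1 := aperyElement_add_div_mul (a := a) hdc l
  have h2 := aperyElement_add_div_mul (a := a) hdc (l + a * t)
  have h3 : (l + a * t) * d / a = l * d / a + t * d := by
    rw [add_mul, mul_assoc, Nat.add_mul_div_left _ _ ha]
  rw [h3] at h2
  have h4 : a * t * d ≤ a * t * c := Nat.mul_le_mul_left _ hdc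
  linarith

theorem aperyElement_le_of_modEq (ha : 0 < a) (hdc : d ≤ c) {l m : ℕ} (hl : l < a)
    (h : l ≡ m [MOD a]) : aperyElement a c d l ≤ aperyElement a c d m := by
  have h1 : l = m % a := (Nat.mod_eq_of_lt hl).symm.trans h
  have h2 := aperyElement_le_add_mul ha hdc l (m / a)
  rwa [h1, Nat.mod_add_div, ← h1] at h2

/-- The elements of the semigroup generated by `a` and the `aperyElement`s are bounded below
by the `aperyElement` of their residue class. -/
theorem aperyElement_le_of_mem_closure (ha : 0 < a) (hdc : d ≤ c) (hc : a ∣ c + 1) {x l : ℕ}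
    (hx : x ∈ AddSubmonoid.closure
      ({a} ∪ {x : ℕ | ∃ l : ℕ, 1 ≤ l ∧ l ≤ a - 1 ∧ x = aperyElement a c d l}))
    (hl : l < a) (hxl : a ∣ x + l) : aperyElement a c d l ≤ x := by
  obtain ⟨m, hm, hxm⟩ : ∃ m, aperyElement a c d m ≤ x ∧ a ∣ x + m := by
    clear hxl
    induction hx using AddSubmonoid.closure_induction with
    | mem x hx =>
      rcases hx with rfl | ⟨m, -, -, rfl⟩
      · exact ⟨0, by simp [aperyElement], by simp⟩
      · exact ⟨m, le_rfl, dvd_aperyElement_add hdc hc m⟩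
    | zero => exact ⟨0, by simp [aperyElement], by simp⟩
    | add x y _ _ hx hy =>
      obtain ⟨m, hm, hxm⟩ := hx
      obtain ⟨n, hn, hyn⟩ := hy
      refine ⟨m + n, (aperyElement_add_le hdc m n).trans (add_le_add hm hn), ?_⟩
      rw [add_add_add_comm]
      exact dvd_add hxm hyn
  have h : x + l ≡ x + m [MOD a] :=
    ((Nat.modEq_zero_iff_dvd).2 hxl).trans ((Nat.modEq_zero_iff_dvd).2 hxm).symm
  exact (aperyElement_le_of_modEq ha hdc hl (Nat.ModEq.add_left_cancel' x h)).trans hm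

/-- If `x ≤ y` both lie in the residue class of `-l` modulo `a`, then `y` is `x` plus a multiple
of `a`. -/
theorem exists_eq_add_mul_of_dvd_add {x y l : ℕ} (hx : a ∣ x + l) (hy : a ∣ y + l)
    (hxy : x ≤ y) : ∃ n, y = x + n * a := by
  obtain ⟨n, hn⟩ := (Nat.dvd_sub hy hx)
  exact ⟨n, by rw [mul_comm n a]; omega⟩

theorem compl_closure_aperyElement (ha : 0 < a) (hdc : d ≤ c) (hc : a ∣ c + 1) :
    {x : ℕ | x ∉ AddSubmonoid.closure
      ({a} ∪ {x : ℕ | ∃ l : ℕ, 1 ≤ l ∧ l ≤ a - 1 ∧ x = aperyElement a c d l})} =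
      {x : ℕ | ∃ l n : ℕ, 1 ≤ l ∧ l ≤ a - 1 ∧ 1 ≤ n ∧ n * a < aperyElement a c d l ∧
        x = aperyElement a c d l - n * a} := by
  ext x
  simp only [Set.mem_ofPred_eq]
  constructor
  · intro hx
    have mul_mem (n : ℕ) : n * a ∈ AddSubmonoid.closure
        ({a} ∪ {x : ℕ | ∃ l : ℕ, 1 ≤ l ∧ l ≤ a - 1 ∧ x = aperyElement a c d l}) := by
      have h : a ∈ AddSubmonoid.closure
          ({a} ∪ {x : ℕ | ∃ l : ℕ, 1 ≤ l ∧ l ≤ a - 1 ∧ x = aperyElement a c d l}) :=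
        AddSubmonoid.subset_closure (Set.mem_union_left _ (Set.mem_singleton a))
      simpa only [smul_eq_mul] using nsmul_mem h n
    have hxa : ¬ a ∣ x := by
      rintro ⟨n, rfl⟩
      exact hx (mul_comm n a ▸ mul_mem n)
    have hpos : 0 < x % a := Nat.pos_of_ne_zero fun h => hxa (Nat.dvd_of_mod_eq_zero h)
    have hlt : x % a < a := Nat.mod_lt x ha
    have hxl : a ∣ x + (a - x % a) := by
      refine ⟨x / a + 1, ?_⟩
      have := Nat.mod_add_div x a
      rw [mul_add]
      omega
    have hMl := dvd_aperyElement_add hdc hc (a - x % a)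
    rcases le_or_gt (aperyElement a c d (a - x % a)) x with hle | hgt
    · obtain ⟨n, hn⟩ := exists_eq_add_mul_of_dvd_add hMl hxl hle
      refine absurd ?_ hx
      rw [hn]
      exact add_mem (AddSubmonoid.subset_closure
        (Set.mem_union_right _ ⟨a - x % a, by omega, by omega, rfl⟩)) (mul_mem n)
    · obtain ⟨n, hn⟩ := exists_eq_add_mul_of_dvd_add hxl hMl hgt.le
      have hx0 : x ≠ 0 := fun h => hxa (h ▸ dvd_zero a)
      have hn0 : n ≠ 0 := by
        rintro rfl
        omega
      exact ⟨a - x % a, n, by omega, by omega, by omega, by omega, by omega⟩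
  · rintro ⟨l, n, hl1, hl2, hn, hlt, hxeq⟩ hx
    have hM : x + n * a = aperyElement a c d l := by omega
    have hdvd : a ∣ x + l := by
      have h := dvd_aperyElement_add hdc hc l
      rw [← hM, add_right_comm] at h
      exact (Nat.dvd_add_left (Nat.dvd_mul_left _ _)).1 h
    have hle := aperyElement_le_of_mem_closure ha hdc hc hx (by omega) hdvd
    have : 0 < n * a := Nat.mul_pos hn ha
    omega

end aperyElement


/-- For `2 ≤ a < b` with `gcd(a,b) = 1` and `r̄` the unique integer with `0 < r̄ ≤ a`,
`b+1 ≡ r̄ (mod a)`, let `H` be the numerical semigroup generated by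
`{a} ∪ {l(b+a−r̄) − ⌊l(a−r̄+1)/a⌋·a : l = 1, …, a−1}`. Then the gaps of `H` are exactly
the positive integers `l(b+a−r̄) − ⌊l(a−r̄+1)/a⌋·a − na` with `1 ≤ l ≤ a−1` and `n ≥ 1`. -/
theorem gaps_of_ramification_semigroup (a b rb : ℕ) (ha : 2 ≤ a) (hab : a < b)
    (hgcd : Nat.gcd a b = 1) (hrb1 : 0 < rb) (hrb2 : rb ≤ a) (hmod : b + 1 ≡ rb [MOD a]) :
    let M : ℕ → ℕ := fun l => l * (b + a - rb) - l * (a - rb + 1) / a * a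
    let H : AddSubmonoid ℕ := AddSubmonoid.closure
      ({a} ∪ {x : ℕ | ∃ l : ℕ, 1 ≤ l ∧ l ≤ a - 1 ∧ x = M l})
    {x : ℕ | x ∉ H} =
      {x : ℕ | ∃ l n : ℕ, 1 ≤ l ∧ l ≤ a - 1 ∧ 1 ≤ n ∧ n * a < M l ∧ x = M l - n * a} := by
  have hc : a ∣ b + a - rb + 1 := by
    have h : a ∣ b + 1 + a - rb := by
      refine (Nat.modEq_iff_dvd' (by omega)).1 ?_
      exact hmod.symm.trans (Nat.add_modEq_right).symm
    rwa [show b + a - rb + 1 = b + 1 + a - rb by omega]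
  exact compl_closure_aperyElement (by omega) (by omega) hc
end

section
/- Let a and b be integers with 2 ≤ a < b and gcd(a, b) = 1, and let r̄ be the unique integer with 0 < r̄ ≤ a and b + 1 ≡ r̄ (mod a). Let H be the numerical semigroup generated by the set S = {a} ∪ { l(b + a − r̄) − ⌊l(a − r̄ + 1)/a⌋·a : l = 1, ..., a−1 }. Then the number of gaps of H is (a−1)(b−1)/2; that is, ℕ \ H is finite of cardinality (a−1)(b−1)/2. -/
/-- The elements `x` of the form `a * n - l` with `l * b ≤ a * n`. -/
def coneSemigroup (a b : ℕ) : AddSubmonoid ℕ where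
  carrier := {x | ∃ l n, x + l = a * n ∧ l * b ≤ a * n}
  zero_mem' := ⟨0, 0, by simp, by simp⟩
  add_mem' := by
    rintro x y ⟨l, n, h1, h2⟩ ⟨l', n', h1', h2'⟩
    exact ⟨l + l', n + n', by linarith, by linarith⟩

theorem mem_coneSemigroup {a b x : ℕ} :
    x ∈ coneSemigroup a b ↔ ∃ l n, x + l = a * n ∧ l * b ≤ a * n := Iff.rfl

theorem mem_coneSemigroup_iff_lt {a b x : ℕ} (ha : 0 < a) (hb : 0 < b) :
    x ∈ coneSemigroup a b ↔ ∃ l n, l < a ∧ x + l = a * n ∧ l * b ≤ a * n := by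
  refine mem_coneSemigroup.trans ⟨?_, fun ⟨l, n, _, h⟩ => ⟨l, n, h⟩⟩
  rintro ⟨l, n, h1, h2⟩
  induction l using Nat.strong_induction_on generalizing n with
  | _ l ih =>
    rcases lt_or_ge l a with hl | hl
    · exact ⟨l, n, hl, h1, h2⟩
    · obtain ⟨m, rfl⟩ := Nat.exists_eq_add_of_le hl
      obtain _ | n := n
      · simp only [mul_zero] at h1
        omega
      · refine ih m (by omega) n (by linarith) ?_
        nlinarith [Nat.mul_le_mul_left a hb]

theorem closure_eq_coneSemigroup {a b d k : ℕ} (ha : 0 < a) (hb : 0 < b) (hd : d ≤ a)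
    (hk : b + d = a * k) (M : ℕ → ℕ)
    (hM : ∀ l, M l + l = a * (l * k - l * d / a)) :
    AddSubmonoid.closure ({a} ∪ {x : ℕ | ∃ l : ℕ, 1 ≤ l ∧ l ≤ a - 1 ∧ x = M l}) =
      coneSemigroup a b := by
  have hdiv (l : ℕ) : a * (l * d / a) ≤ l * d := Nat.mul_div_le _ _
  have hlk (l : ℕ) : a * (l * k) = l * b + l * d := by
    rw [mul_left_comm, ← hk, mul_add]
  apply le_antisymm
  · rw [AddSubmonoid.closure_le]
    rintro x (rfl | ⟨l, -, -, rfl⟩)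
    · exact ⟨0, 1, by simp, by simp⟩
    · refine ⟨l, _, hM l, ?_⟩
      rw [Nat.mul_sub]
      have := hdiv l
      have := hlk l
      omega
  · intro x hx
    obtain ⟨l, n, hl, h1, h2⟩ := (mem_coneSemigroup_iff_lt ha hb).1 hx
    have hmul (m : ℕ) : a * m ∈ AddSubmonoid.closure
        ({a} ∪ {x : ℕ | ∃ l : ℕ, 1 ≤ l ∧ l ≤ a - 1 ∧ x = M l}) := by
      rw [mul_comm a m, ← smul_eq_mul]
      exact nsmul_mem (AddSubmonoid.mem_closure_of_mem
        (Set.mem_union_left _ (Set.mem_singleton a))) m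
    rcases Nat.eq_zero_or_pos l with rfl | hl0
    · rw [add_zero] at h1
      rw [h1]
      exact hmul n
    · have hc : l * k - l * d / a ≤ n := by
        have : l * k - n ≤ l * d / a := by
          rw [Nat.le_div_iff_mul_le ha, mul_comm, Nat.mul_sub]
          have := hlk l
          omega
        omega
      obtain ⟨m, rfl⟩ := Nat.exists_eq_add_of_le hc
      have hx' : x = M l + a * m := by
        have := hM l
        rw [mul_add] at h1
        omega
      rw [hx']
      exact add_mem (AddSubmonoid.mem_closure_of_mem (Or.inr ⟨l, hl0, by omega, rfl⟩)) (hmul m)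

/-- The lattice points strictly inside the rectangle `[0, a] × [0, b]` and strictly below its
diagonal. -/
def pointsBelowDiagonal (a b : ℕ) : Finset (ℕ × ℕ) :=
  (Finset.Ico 1 a ×ˢ Finset.Ico 1 b).filter fun p => a * p.2 < p.1 * b

theorem two_mul_card_pointsBelowDiagonal {a b : ℕ} (hgcd : Nat.gcd a b = 1) :
    2 * (pointsBelowDiagonal a b).card = (a - 1) * (b - 1) := by
  have hrefl : (pointsBelowDiagonal a b).card =
      ((Finset.Ico 1 a ×ˢ Finset.Ico 1 b).filter fun p => ¬ a * p.2 < p.1 * b).card := by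
    refine Finset.card_nbij' (fun p => (a - p.1, b - p.2)) (fun p => (a - p.1, b - p.2))
      ?_ ?_ ?_ ?_
    · rintro ⟨l, n⟩ h
      simp only [pointsBelowDiagonal, Finset.coe_filter, Finset.mem_product, Finset.mem_Ico,
        Set.mem_ofPred_eq] at h ⊢
      obtain ⟨⟨⟨hl, hl'⟩, hn, hn'⟩, h⟩ := h
      refine ⟨by omega, ?_⟩
      rw [Nat.mul_sub, Nat.sub_mul]
      omega
    · rintro ⟨l, n⟩ h
      simp only [pointsBelowDiagonal, Finset.coe_filter, Finset.mem_product, Finset.mem_Ico,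
        Set.mem_ofPred_eq] at h ⊢
      obtain ⟨⟨⟨hl, hl'⟩, hn, hn'⟩, h⟩ := h
      refine ⟨by omega, ?_⟩
      have hne : a * n ≠ l * b := fun he =>
        Nat.not_dvd_of_pos_of_lt hl hl' (Nat.Coprime.dvd_of_dvd_mul_right hgcd ⟨n, he.symm⟩)
      have : l * b < a * b := Nat.mul_lt_mul_of_pos_right hl' (by omega)
      have : a * n < a * b := Nat.mul_lt_mul_of_pos_left hn' (by omega)
      rw [Nat.mul_sub, Nat.sub_mul]
      omega
    · rintro ⟨l, n⟩ h
      simp only [pointsBelowDiagonal, Finset.coe_filter, Finset.mem_product, Finset.mem_Ico,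
        Set.mem_ofPred_eq] at h
      ext <;> dsimp only <;> omega
    · rintro ⟨l, n⟩ h
      simp only [Finset.coe_filter, Finset.mem_product, Finset.mem_Ico, Set.mem_ofPred_eq] at h
      ext <;> dsimp only <;> omega
  have hsum := Finset.card_filter_add_card_filter_not (s := Finset.Ico 1 a ×ˢ Finset.Ico 1 b)
    (fun p : ℕ × ℕ => a * p.2 < p.1 * b)
  rw [← hrefl, Finset.card_product, Nat.card_Ico, Nat.card_Ico] at hsum
  rw [two_mul, ← hsum, pointsBelowDiagonal]

theorem eq_and_eq_of_add_eq_mul {a l l' n n' x : ℕ} (hl : l < a) (hl' : l' < a)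
    (h : x + l = a * n) (h' : x + l' = a * n') : l = l' ∧ n = n' := by
  have hll : l = l' := by
    have hmod : x + l ≡ x + l' [MOD a] := by
      rw [h, h']
      exact (Nat.modEq_zero_iff_dvd.2 ⟨n, rfl⟩).trans (Nat.modEq_zero_iff_dvd.2 ⟨n', rfl⟩).symm
    exact (Nat.ModEq.add_left_cancel' x hmod).eq_of_lt_of_lt hl hl'
  subst hll
  exact ⟨rfl, Nat.eq_of_mul_eq_mul_left (by omega) (h.symm.trans h')⟩

theorem mul_sub_add_cancel_of_lt {a l n : ℕ} (hl : l < a) (hn : 1 ≤ n) : a * n - l + l = a * n :=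
  Nat.sub_add_cancel (hl.le.trans (Nat.le_mul_of_pos_right a hn))

theorem gaps_coneSemigroup {a b : ℕ} (ha : 0 < a) (hb : 0 < b) :
    {x : ℕ | x ∉ coneSemigroup a b} =
      (fun p : ℕ × ℕ => a * p.2 - p.1) '' (pointsBelowDiagonal a b : Set (ℕ × ℕ)) := by
  ext x
  simp only [Set.mem_ofPred_eq, Set.mem_image, pointsBelowDiagonal, Finset.coe_filter,
    Finset.mem_product, Finset.mem_Ico, Prod.exists]
  constructor
  · intro hx
    obtain ⟨l, n, hl, h⟩ : ∃ l n, l < a ∧ x + l = a * n := by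
      have hdm := Nat.div_add_mod x a
      have hlt := Nat.mod_lt x ha
      rcases Nat.eq_zero_or_pos (x % a) with h0 | h0
      · exact ⟨0, x / a, ha, by omega⟩
      · exact ⟨a - x % a, x / a + 1, by omega, by rw [mul_add]; omega⟩
    have hlt : a * n < l * b := by
      by_contra! hle
      exact hx ⟨l, n, h, hle⟩
    have hl0 : 1 ≤ l := by
      by_contra! h0
      simp [Nat.lt_one_iff.1 h0] at hlt
    have hn0 : 1 ≤ n := by
      by_contra! h0
      rw [Nat.lt_one_iff.1 h0, mul_zero] at h
      omega
    have hnb : n < b := by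
      have : l * b ≤ a * b := Nat.mul_le_mul_right b hl.le
      exact Nat.lt_of_mul_lt_mul_left (hlt.trans_le this)
    exact ⟨l, n, ⟨⟨⟨hl0, hl⟩, hn0, hnb⟩, hlt⟩, by omega⟩
  · rintro ⟨l, n, ⟨⟨⟨-, hl⟩, hn, -⟩, hlt⟩, rfl⟩ hx
    obtain ⟨l', n', hl', h, hle⟩ := (mem_coneSemigroup_iff_lt ha hb).1 hx
    obtain ⟨rfl, rfl⟩ := eq_and_eq_of_add_eq_mul hl' hl h (mul_sub_add_cancel_of_lt hl hn)
    omega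

theorem ncard_gaps_coneSemigroup {a b : ℕ} (ha : 0 < a) (hb : 0 < b) (hgcd : Nat.gcd a b = 1) :
    {x : ℕ | x ∉ coneSemigroup a b}.ncard = (a - 1) * (b - 1) / 2 := by
  rw [gaps_coneSemigroup ha hb, Set.InjOn.ncard_image, Set.ncard_coe_finset]
  · have := two_mul_card_pointsBelowDiagonal hgcd
    omega
  · rintro ⟨l, n⟩ h ⟨l', n'⟩ h' heq
    simp only [pointsBelowDiagonal, Finset.coe_filter, Finset.mem_product, Finset.mem_Ico,
      Set.mem_ofPred_eq] at h h' heq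
    have h1 := mul_sub_add_cancel_of_lt h.1.1.2 h.1.2.1
    have h2 := mul_sub_add_cancel_of_lt h'.1.1.2 h'.1.2.1
    rw [← heq] at h2
    obtain ⟨rfl, rfl⟩ := eq_and_eq_of_add_eq_mul h.1.1.2 h'.1.1.2 h1 h2
    rfl


/-- For `2 ≤ a < b` with `gcd(a,b) = 1` and `r̄` the unique integer with `0 < r̄ ≤ a`,
`b+1 ≡ r̄ (mod a)`, let `H` be the numerical semigroup generated by
`{a} ∪ {l(b+a−r̄) − ⌊l(a−r̄+1)/a⌋·a : l = 1, …, a−1}`. Then the set of gaps of `H` is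
finite of cardinality `(a−1)(b−1)/2`. -/
theorem genus_of_ramification_semigroup (a b rb : ℕ) (ha : 2 ≤ a) (hab : a < b)
    (hgcd : Nat.gcd a b = 1) (hrb1 : 0 < rb) (hrb2 : rb ≤ a) (hmod : b + 1 ≡ rb [MOD a]) :
    let M : ℕ → ℕ := fun l => l * (b + a - rb) - l * (a - rb + 1) / a * a
    let H : AddSubmonoid ℕ := AddSubmonoid.closure
      ({a} ∪ {x : ℕ | ∃ l : ℕ, 1 ≤ l ∧ l ≤ a - 1 ∧ x = M l})
    {x : ℕ | x ∉ H}.Finite ∧ {x : ℕ | x ∉ H}.ncard = (a - 1) * (b - 1) / 2 := by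
  intro M H
  obtain ⟨k, hk⟩ : a ∣ b + (a - rb + 1) := by
    have h : b + 1 + (a - rb) ≡ rb + (a - rb) [MOD a] := hmod.add_right _
    rw [Nat.add_sub_cancel' hrb2] at h
    have := Nat.modEq_zero_iff_dvd.1 (h.trans (Nat.modEq_zero_iff_dvd.2 dvd_rfl))
    rwa [show b + (a - rb + 1) = b + 1 + (a - rb) by omega]
  have hb : 0 < b := by omega
  have hH : H = coneSemigroup a b := by
    refine closure_eq_coneSemigroup (by omega) hb (by omega) hk M fun l => ?_
    have h1 : l * (b + a - rb) + l = a * (l * k) := by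
      rw [mul_left_comm, ← hk, ← Nat.mul_succ]
      congr 1
      omega
    have h2 : l * (a - rb + 1) / a * a ≤ l * (b + a - rb) :=
      (Nat.div_mul_le_self _ _).trans (Nat.mul_le_mul_left l (by omega))
    have h3 : a * (l * (a - rb + 1) / a) = l * (a - rb + 1) / a * a := mul_comm _ _
    rw [Nat.mul_sub a]
    dsimp only [M]
    omega
  rw [hH]
  refine ⟨?_, ncard_gaps_coneSemigroup (by omega) hb hgcd⟩
  rw [gaps_coneSemigroup (by omega) hb]
  exact (Finset.finite_toSet _).image _
end

section
/- Let a and b be integers with 2 ≤ a < b and gcd(a, b) = 1, and let r̄ be the unique integer with 0 < r̄ ≤ a and b + 1 ≡ r̄ (mod a). Let H be the numerical semigroup generated by the set S = {a} ∪ { l(b + a − r̄) − ⌊l(a − r̄ + 1)/a⌋·a : l = 1, ..., a−1 }. Then H = ⟨a, b⟩ if and only if b ≡ a−1 (mod a) (equivalently, if and only if r̄ = a). -/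
/-- A combination `x * a + y * b` equal to `b + a - r`, where `r ≡ b + 1 (mod a)`,
forces `r = a`. -/
theorem eq_of_mul_add_mul_eq_add_sub {a b r x y : ℕ} (ha : 2 ≤ a) (hab : a < b)
    (hr1 : 0 < r) (hr2 : r ≤ a) (hmod : b + 1 ≡ r [MOD a])
    (hxy : x * a + y * b = b + a - r) : r = a := by
  rcases y with _ | _ | y
  · exfalso
    have h1 : x * a + r = b + a := by omega
    have h2 : r ≡ b [MOD a] := by
      have h3 : (x * a + r) % a = (b + a) % a := by rw [h1]
      simpa [Nat.ModEq] using h3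
    have h4 : b + 1 ≡ b + 0 [MOD a] := hmod.trans h2
    have h5 := (Nat.modEq_zero_iff_dvd.1 (Nat.ModEq.add_left_cancel' b h4))
    have := Nat.le_of_dvd one_pos h5
    omega
  · have h1 : x * a + r = a := by omega
    rcases x with _ | x
    · simpa using h1
    · nlinarith [Nat.zero_le (x * a)]
  · nlinarith [Nat.zero_le (x * a), Nat.zero_le (y * b), Nat.sub_le (b + a) r,
      Nat.sub_add_cancel (show r ≤ b + a by omega)]

/-- Given `b + 1 ≡ r (mod a)` with `0 < r ≤ a`, the residue of `b` is `a - 1` exactly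
when `r = a`. -/
theorem modEq_sub_one_iff_eq {a b r : ℕ} (hr1 : 0 < r) (hr2 : r ≤ a)
    (hmod : b + 1 ≡ r [MOD a]) : b ≡ a - 1 [MOD a] ↔ r = a := by
  have hsub : a - 1 + 1 = a := by omega
  constructor
  · intro h
    have h1 : r ≡ a [MOD a] := by
      have h2 := h.add_right 1
      rw [hsub] at h2
      exact hmod.symm.trans h2
    have h2 : a ∣ r := (h1.dvd_iff dvd_rfl).2 dvd_rfl
    exact le_antisymm hr2 (Nat.le_of_dvd hr1 h2)
  · rintro rfl
    refine Nat.ModEq.add_right_cancel' 1 ?_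
    rwa [hsub]


/-- Remark 2.11: for `2 ≤ a < b` with `gcd(a,b) = 1` and `r̄` the unique integer with
`0 < r̄ ≤ a`, `b+1 ≡ r̄ (mod a)`, the numerical semigroup `H` generated by
`{a} ∪ {l(b+a−r̄) − ⌊l(a−r̄+1)/a⌋·a : l = 1, …, a−1}` equals `⟨a,b⟩` if and only if
`b ≡ a−1 (mod a)` (equivalently, if and only if `r̄ = a`). -/
theorem ramification_semigroup_eq_iff (a b rb : ℕ) (ha : 2 ≤ a) (hab : a < b)
    (hgcd : Nat.gcd a b = 1) (hrb1 : 0 < rb) (hrb2 : rb ≤ a) (hmod : b + 1 ≡ rb [MOD a]) :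
    let M : ℕ → ℕ := fun l => l * (b + a - rb) - l * (a - rb + 1) / a * a
    (AddSubmonoid.closure ({a} ∪ {x : ℕ | ∃ l : ℕ, 1 ≤ l ∧ l ≤ a - 1 ∧ x = M l}) =
        AddSubmonoid.closure {a, b} ↔ b ≡ a - 1 [MOD a]) ∧
      (b ≡ a - 1 [MOD a] ↔ rb = a) := by
  intro M
  have hiff := modEq_sub_one_iff_eq hrb1 hrb2 hmod
  refine ⟨?_, hiff⟩
  rw [hiff]
  constructor
  · intro h
    by_contra hne
    have hrb : rb ≠ 1 := by
      rintro rfl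
      have hdvd : a ∣ b :=
        Nat.modEq_zero_iff_dvd.1 (Nat.ModEq.add_right_cancel' 1 hmod)
      rw [Nat.gcd_eq_left hdvd] at hgcd
      omega
    have hM : M 1 = b + a - rb := by
      have h0 : (a - rb + 1) / a = 0 := Nat.div_eq_of_lt (by omega)
      simp [M, h0]
    have hmem : M 1 ∈ AddSubmonoid.closure ({a, b} : Set ℕ) := by
      rw [← h]
      exact AddSubmonoid.subset_closure (Or.inr ⟨1, le_rfl, by omega, rfl⟩)
    obtain ⟨x, y, hxy⟩ := (AddSubmonoid.mem_closure_pair _ _ _).1 hmem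
    rw [hM, smul_eq_mul, smul_eq_mul] at hxy
    exact hne (eq_of_mul_add_mul_eq_add_sub ha hab hrb1 hrb2 hmod hxy)
  · rintro rfl
    have hM : ∀ l ≤ rb - 1, M l = l * b := by
      intro l hl
      have h0 : l / rb = 0 := Nat.div_eq_of_lt (by omega)
      simp [M, h0]
    apply le_antisymm
    · rw [AddSubmonoid.closure_le]
      rintro x (rfl | ⟨l, -, hl, rfl⟩)
      · exact AddSubmonoid.subset_closure (Or.inl rfl)
      · rw [SetLike.mem_coe, hM l hl, ← smul_eq_mul]
        exact nsmul_mem (AddSubmonoid.subset_closure (by simp)) l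
    · rw [AddSubmonoid.closure_le]
      rintro x (rfl | rfl)
      · exact AddSubmonoid.subset_closure (Or.inl rfl)
      · refine AddSubmonoid.subset_closure (Or.inr ⟨1, le_rfl, by omega, ?_⟩)
        rw [hM 1 (by omega), one_mul]
end
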